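/- The abelian Lie algebra 𝔤₄ = {T(0,b) | b ∈ ℍ, Re b = 0} is a Berger algebra: the endomorphisms R(u, v), for R an algebraic curvature tensor of type 𝔤₄ and u, v ∈ V, span 𝔤₄ over ℝ. -/

import Mathlib

open Quaternion

noncomputable section

/-- `V = ℍ × ℍ`, the pseudo-quaternionic-Hermitian space `ℍ^{1,1}` in an isotropic basis
`p = (1,0)`, `q = (0,1)`. -/
abbrev V : Type := ℍ[ℝ] × ℍ[ℝ]

/-- The neutral-signature metric `η((x,y),(x',y')) = Re(x conj(y') + y conj(x'))`. -/
def η (u v : V) : ℝ := (u.1 * star v.2 + u.2 * star v.1).re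

/-- The endomorphism of `ℍ^{1,1}` with matrix `[[a, b], [0, -conj a]]` in the isotropic
basis `(p, q)`: `T(a,b)(x,y) = (x a + y b, − y conj(a))`. -/
def T (a b : ℍ[ℝ]) : Module.End ℝ V where
  toFun u := (u.1 * a + u.2 * b, -(u.2 * star a))
  map_add' u v := by
    simp only [Prod.fst_add, Prod.snd_add, add_mul, Prod.mk_add_mk, Prod.mk.injEq]
    constructor <;> abel
  map_smul' r u := by
    simp only [Prod.smul_fst, Prod.smul_snd, RingHom.id_apply, Prod.smul_mk,
      smul_mul_assoc, smul_add, smul_neg]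

/-- `R` is an algebraic curvature tensor of type `g`: a bilinear alternating map
`V × V → End_ℝ(V)` with values in `g` satisfying the first Bianchi identity. -/
def IsCurv (g : Set (Module.End ℝ V)) (R : V →ₗ[ℝ] V →ₗ[ℝ] Module.End ℝ V) : Prop :=
  (∀ u v : V, R u v = - R v u) ∧ (∀ u v : V, R u v ∈ g) ∧
  (∀ u v w : V, R u v w + R v w u + R w u v = 0)

/-- The abelian Lie algebra `𝔤₄ = {T(0,b) | b ∈ Im ℍ}`. -/
def g : Set (Module.End ℝ V) := {f | ∃ b : ℍ[ℝ], b.re = 0 ∧ f = T 0 b}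

/-- The `Im ℍ`-valued form `A (Im (conj y₁ * y₂))` on the second components, where
`A = diag (1, 1, -2)` is a traceless symmetric endomorphism of `Im ℍ`. -/
def weylForm (u v : V) : ℍ[ℝ] :=
  ⟨0, (star u.2 * v.2).imI, (star u.2 * v.2).imJ, -2 * (star u.2 * v.2).imK⟩

section weylForm

variable (u v w : V)

@[simp] theorem re_weylForm : (weylForm u v).re = 0 := rfl

@[simp] theorem imI_weylForm : (weylForm u v).imI = (star u.2 * v.2).imI := rfl

@[simp] theorem imJ_weylForm : (weylForm u v).imJ = (star u.2 * v.2).imJ := rfl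

@[simp] theorem imK_weylForm : (weylForm u v).imK = -2 * (star u.2 * v.2).imK := rfl

theorem weylForm_swap : weylForm v u = -weylForm u v := by
  ext <;> simp <;> ring

theorem weylForm_add_right : weylForm u (v + w) = weylForm u v + weylForm u w := by
  ext <;> simp <;> ring

theorem weylForm_smul_right (c : ℝ) : weylForm u (c • v) = c • weylForm u v := by
  ext <;> simp <;> ring

theorem weylForm_add_left : weylForm (u + v) w = weylForm u w + weylForm v w := by
  rw [weylForm_swap, weylForm_add_right, weylForm_swap u, weylForm_swap v, neg_add, neg_neg,
    neg_neg]

theorem weylForm_smul_left (c : ℝ) : weylForm (c • u) v = c • weylForm u v := by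
  rw [weylForm_swap, weylForm_smul_right, weylForm_swap u, smul_neg, neg_neg]

theorem weylForm_bianchi :
    w.2 * weylForm u v + u.2 * weylForm v w + v.2 * weylForm w u = 0 := by
  ext <;> simp <;> ring

theorem exists_weylForm_eq {b : ℍ[ℝ]} (hb : b.re = 0) : ∃ u v : V, weylForm u v = b := by
  obtain ⟨c, hI, hJ, hK⟩ : ∃ c : ℍ[ℝ], c.imI = b.imI ∧ c.imJ = b.imJ ∧ -2 * c.imK = b.imK :=
    ⟨⟨0, b.imI, b.imJ, -b.imK / 2⟩, rfl, rfl, by ring⟩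
  refine ⟨(0, 1), (0, c), ?_⟩
  ext
  · rw [re_weylForm, hb]
  · simpa using hI
  · simpa using hJ
  · simpa using hK

end weylForm

theorem T_zero_apply (b : ℍ[ℝ]) (u : V) : T 0 b u = (u.2 * b, 0) := by
  simp [T]

/-- The linear map `b ↦ T 0 b`. -/
def linearT : ℍ[ℝ] →ₗ[ℝ] Module.End ℝ V where
  toFun b := T 0 b
  map_add' b c := LinearMap.ext fun u => by simp [T_zero_apply, mul_add]
  map_smul' r b := LinearMap.ext fun u => by simp [T_zero_apply]

/-- The curvature tensor `(u, v) ↦ T 0 (weylForm u v)`. -/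
def weylCurv : V →ₗ[ℝ] V →ₗ[ℝ] Module.End ℝ V :=
  (LinearMap.mk₂ ℝ weylForm weylForm_add_left (fun c u v => weylForm_smul_left u v c)
    weylForm_add_right (fun c u v => weylForm_smul_right u v c)).compr₂ linearT

theorem weylCurv_apply (u v : V) : weylCurv u v = T 0 (weylForm u v) := rfl

theorem isCurv_weylCurv : IsCurv g weylCurv := by
  refine ⟨fun u v => ?_, fun u v => ⟨weylForm u v, rfl, rfl⟩, fun u v w => ?_⟩
  · rw [weylCurv_apply, weylCurv_apply, weylForm_swap]
    exact map_neg linearT _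
  · simp only [weylCurv_apply, T_zero_apply, Prod.mk_add_mk, weylForm_bianchi, add_zero,
      Prod.mk_zero_zero]

/-- this Lie algebra is a Berger algebra: the endomorphisms `R u v`, for
`R` an algebraic curvature tensor of type the algebra and `u, v ∈ V`, span it over ℝ. -/
theorem g4_is_berger_algebra :
    Submodule.span ℝ {f : Module.End ℝ V |
        ∃ R : V →ₗ[ℝ] V →ₗ[ℝ] Module.End ℝ V, IsCurv g R ∧ ∃ u v : V, f = R u v}
      = Submodule.span ℝ g := by
  congr 1
  ext f
  constructor
  · rintro ⟨R, hR, u, v, rfl⟩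
    exact hR.2.1 u v
  · rintro ⟨b, hb, rfl⟩
    obtain ⟨u, v, rfl⟩ := exists_weylForm_eq hb
    exact ⟨weylCurv, isCurv_weylCurv, u, v, rfl⟩

end
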